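/- Let 𝒜 be a unital complex Banach algebra (a complete normed ring that is a normed algebra over ℂ, with 1 ≠ 0), and let x, y ∈ 𝒜 with x * y = y * x. Then spectrum ℂ (x * y) ⊆ spectrum ℂ x * spectrum ℂ y, where the right-hand side is the set of all products λ * μ with λ ∈ spectrum ℂ x and μ ∈ spectrum ℂ y. -/

import Mathlib

open Pointwise

/-- An element of a centralizer that is invertible in the ambient algebra is invertible in the
centralizer. -/
theorem Subalgebra.isUnit_centralizer_iff {R A : Type*} [CommSemiring R] [Semiring A]
    [Algebra R A] {s : Set A} (a : Subalgebra.centralizer R s) :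
    IsUnit a ↔ IsUnit (a : A) := by
  refine ⟨fun h => h.map (Subalgebra.centralizer R s).val, fun h => ?_⟩
  obtain ⟨u, hu⟩ := h
  have hinv : (↑u⁻¹ : A) ∈ Subalgebra.centralizer R s := by
    rw [Subalgebra.mem_centralizer_iff]
    intro g hg
    have hcomm : Commute g (u : A) := by
      rw [hu]
      exact Subalgebra.mem_centralizer_iff R |>.mp a.2 g hg
    exact hcomm.units_inv_right
  exact ⟨⟨a, ⟨↑u⁻¹, hinv⟩, Subtype.ext (by simp [← hu]), Subtype.ext (by simp [← hu])⟩, rfl⟩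

/-- Centralizers are spectrally closed: the spectrum does not change on passing to a centralizer. -/
theorem Subalgebra.spectrum_centralizer_eq {R A : Type*} [CommRing R] [Ring A]
    [Algebra R A] {s : Set A} (a : Subalgebra.centralizer R s) :
    spectrum R a = spectrum R (a : A) := by
  ext r
  rw [spectrum.mem_iff, spectrum.mem_iff, Subalgebra.isUnit_centralizer_iff]
  rfl

/-- In a commutative complex Banach algebra, the spectrum of a product is contained in the product
of the spectra. -/
theorem spectrum_mul_subset {A : Type*} [NormedCommRing A] [NormedAlgebra ℂ A] [CompleteSpace A]
    (x y : A) : spectrum ℂ (x * y) ⊆ spectrum ℂ x * spectrum ℂ y := by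
  intro z hz
  obtain ⟨φ, rfl⟩ := WeakDual.CharacterSpace.mem_spectrum_iff_exists.mp hz
  rw [map_mul]
  exact Set.mul_mem_mul (AlgHom.apply_mem_spectrum φ x) (AlgHom.apply_mem_spectrum φ y)

/-- In a unital complex Banach algebra, the spectrum of a product of commuting
elements is contained in the (pointwise) product of the spectra. -/
theorem spectrum_mul_subset_of_commute {𝒜 : Type*} [NormedRing 𝒜]
    [NormedAlgebra ℂ 𝒜] [CompleteSpace 𝒜] [Nontrivial 𝒜]
    (x y : 𝒜) (hxy : x * y = y * x) :
    spectrum ℂ (x * y) ⊆ spectrum ℂ x * spectrum ℂ y := by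
  let s : Set 𝒜 := {x, y}
  have hs : ∀ a ∈ s, ∀ b ∈ s, a * b = b * a := by
    rintro a (rfl | rfl) b (rfl | rfl) <;> simp [hxy]
  let B := Subalgebra.centralizer ℂ s.centralizer
  let _ : NormedCommRing B :=
    { (inferInstance : NormedRing B) with
      mul_comm := fun a b => Subtype.ext
        (Set.centralizer_centralizer_comm_of_comm hs a a.2 b b.2) }
  have : CompleteSpace B :=
    (Set.isClosed_centralizer s.centralizer).completeSpace_coe
  let x' : B := ⟨x, Set.subset_centralizer_centralizer (Set.mem_insert x {y})⟩
  let y' : B := ⟨y, Set.subset_centralizer_centralizer (Set.mem_insert_of_mem x rfl)⟩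
  have h := spectrum_mul_subset x' y'
  rwa [Subalgebra.spectrum_centralizer_eq x', Subalgebra.spectrum_centralizer_eq y',
    Subalgebra.spectrum_centralizer_eq (x' * y')] at h
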